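/- (Sobolev product law, Fourier-side form, second part.) Let s₁, s₂ ∈ ℝ with s₁ + s₂ > 0, s₁ < 3/2 and s₂ < 3/2. There exists a constant C = C(s₁, s₂) > 0 such that for all measurable functions F, G : ℝ³ → ℂ with ∫_{ℝ³} |ξ|^{2s₁}|F(ξ)|² dξ < ∞ and ∫_{ℝ³} |ξ|^{2s₂}|G(ξ)|² dξ < ∞, the convolution (F∗G)(ξ) = ∫_{ℝ³} F(η)·G(ξ − η) dη is well defined for almost every ξ and satisfies (∫_{ℝ³} |ξ|^{2(s₁+s₂−3/2)} |(F∗G)(ξ)|² dξ)^{1/2} ≤ C·(∫_{ℝ³} |ξ|^{2s₁}|F(ξ)|² dξ)^{1/2}·(∫_{ℝ³} |ξ|^{2s₂}|G(ξ)|² dξ)^{1/2}. -/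

import Mathlib

open MeasureTheory
open Module (finrank)
open scoped ENNReal

/-- The homogeneous weight `‖x‖ ^ r`, valued in `ℝ≥0∞`. -/
noncomputable def normWeight {E : Type*} [Norm E] (r : ℝ) (x : E) : ℝ≥0∞ :=
  ENNReal.ofReal (‖x‖ ^ r)

section Weight

variable {E : Type*} [NormedAddCommGroup E]

theorem normWeight_mul {x : E} (hx : x ≠ 0) (r s : ℝ) :
    normWeight r x * normWeight s x = normWeight (r + s) x := by
  rw [normWeight, normWeight, normWeight, Real.rpow_add (norm_pos_iff.2 hx),
    ENNReal.ofReal_mul (by positivity)]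

theorem normWeight_ne_top (r : ℝ) (x : E) : normWeight r x ≠ ∞ := ENNReal.ofReal_ne_top

theorem normWeight_ne_zero {x : E} (hx : x ≠ 0) (r : ℝ) : normWeight r x ≠ 0 := by
  have := norm_pos_iff.2 hx
  rw [normWeight, Ne, ENNReal.ofReal_eq_zero, not_le]
  positivity

theorem normWeight_mul_neg {x : E} (hx : x ≠ 0) (r : ℝ) :
    normWeight r x * normWeight (-r) x = 1 := by
  rw [normWeight_mul hx]
  simp [normWeight]

theorem normWeight_sq (r : ℝ) (x : E) : normWeight r x ^ 2 = normWeight (2 * r) x := by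
  rw [normWeight, normWeight, ← ENNReal.ofReal_pow (by positivity), mul_comm,
    Real.rpow_mul (norm_nonneg x), Real.rpow_two]

@[fun_prop]
theorem measurable_normWeight [MeasurableSpace E] [BorelSpace E] (r : ℝ) :
    Measurable (normWeight r : E → ℝ≥0∞) := by
  unfold normWeight
  fun_prop

theorem normWeight_le_of_comparable (r : ℝ) {x y : E} (hx : x ≠ 0) (hxy : ‖x‖ ≤ 2 * ‖y‖)
    (hyx : ‖y‖ ≤ 2 * ‖x‖) :
    normWeight r x ≤ ENNReal.ofReal (2 ^ |r|) * normWeight r y := by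
  have hx' : 0 < ‖x‖ := norm_pos_iff.2 hx
  have hy' : 0 < ‖y‖ := by linarith
  rw [normWeight, normWeight, ← ENNReal.ofReal_mul (by positivity)]
  apply ENNReal.ofReal_le_ofReal
  rcases le_total 0 r with hr | hr
  · rw [abs_of_nonneg hr, ← Real.mul_rpow two_pos.le hy'.le]
    exact Real.rpow_le_rpow hx'.le hxy hr
  · rw [abs_of_nonpos hr]
    have h := Real.rpow_le_rpow_of_nonpos hy' hyx hr
    rw [Real.mul_rpow two_pos.le hx'.le] at h
    rw [Real.rpow_neg two_pos.le, inv_mul_eq_div, le_div_iff₀ (by positivity)]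
    linarith

end Weight

theorem lintegral_mul_sq_le {α : Type*} [MeasurableSpace α] {μ : Measure α} {f g : α → ℝ≥0∞}
    (hf : AEMeasurable f μ) (hg : AEMeasurable g μ) :
    (∫⁻ x, f x * g x ∂μ) ^ 2 ≤ (∫⁻ x, f x ^ 2 ∂μ) * ∫⁻ x, g x ^ 2 ∂μ := by
  have h := ENNReal.lintegral_mul_le_Lp_mul_Lq μ Real.HolderConjugate.two_two hf hg
  calc (∫⁻ x, f x * g x ∂μ) ^ 2
      ≤ ((∫⁻ x, f x ^ (2 : ℝ) ∂μ) ^ (1 / 2 : ℝ) * (∫⁻ x, g x ^ (2 : ℝ) ∂μ) ^ (1 / 2 : ℝ)) ^ 2 := by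
        gcongr
        exact h
    _ = (∫⁻ x, f x ^ 2 ∂μ) * ∫⁻ x, g x ^ 2 ∂μ := by
        rw [mul_pow, ← ENNReal.rpow_mul_natCast, ← ENNReal.rpow_mul_natCast]
        simp

theorem measurable_setLIntegral_slice {α β : Type*} [MeasurableSpace α] [MeasurableSpace β]
    (ν : Measure β) [SFinite ν] {S : Set (α × β)} (hS : MeasurableSet S) {h : α → β → ℝ≥0∞}
    (hh : Measurable (Function.uncurry h)) :
    Measurable fun z => ∫⁻ x in {x | (z, x) ∈ S}, h z x ∂ν := by
  have key : (fun z => ∫⁻ x in {x | (z, x) ∈ S}, h z x ∂ν) =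
      fun z => ∫⁻ x, S.indicator (Function.uncurry h) (z, x) ∂ν := by
    ext z
    rw [← lintegral_indicator (show MeasurableSet {x | (z, x) ∈ S} from measurable_prodMk_left hS)]
    rfl
  rw [key]
  exact (hh.indicator hS).lintegral_prod_right'

theorem ENNReal.add_add_sq_le (a b c : ℝ≥0∞) :
    (a + b + c) ^ 2 ≤ 9 * (a ^ 2 + b ^ 2 + c ^ 2) := by
  have key (m : ℝ≥0∞) (ha : a ≤ m) (hb : b ≤ m) (hc : c ≤ m) : (a + b + c) ^ 2 ≤ 9 * m ^ 2 :=
    calc (a + b + c) ^ 2 ≤ (m + m + m) ^ 2 := by gcongr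
      _ = 9 * m ^ 2 := by ring
  rcases max_choice a (max b c) with h | h
  · refine (key a le_rfl ?_ ?_).trans ?_
    · exact (le_max_left b c).trans (max_eq_left_iff.1 h)
    · exact (le_max_right b c).trans (max_eq_left_iff.1 h)
    · rw [add_assoc]
      gcongr
      exact le_self_add
  · have h' := max_eq_right_iff.1 h
    rcases le_total b c with hbc | hbc
    · rw [max_eq_right hbc] at h'
      refine (key c h' hbc le_rfl).trans ?_
      gcongr
      exact le_add_self
    · rw [max_eq_left hbc] at h'
      refine (key b h' le_rfl hbc).trans ?_
      gcongr
      exact le_add_self.trans le_self_add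

section Haar

variable {E : Type*} [NormedAddCommGroup E] [NormedSpace ℝ E] [FiniteDimensional ℝ E]
  [MeasurableSpace E] [BorelSpace E] (μ : Measure E) [μ.IsAddHaarMeasure]

theorem lintegral_comp_smul_addHaar {f : E → ℝ≥0∞} (hf : Measurable f) {R : ℝ} (hR : 0 < R) :
    ∫⁻ x, f x ∂μ = ENNReal.ofReal (R ^ finrank ℝ E) * ∫⁻ x, f (R • x) ∂μ := by
  rw [← lintegral_map hf (measurable_const_smul R), Measure.map_addHaar_smul μ hR.ne',
    lintegral_smul_measure, smul_eq_mul, ← mul_assoc, ← ENNReal.ofReal_mul (by positivity),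
    abs_of_pos (by positivity), mul_inv_cancel₀ (by positivity), ENNReal.ofReal_one, one_mul]

theorem lintegral_closedBall_one_normWeight_lt_top [Nontrivial E] {r : ℝ}
    (hr : -(finrank ℝ E : ℝ) < r) :
    ∫⁻ x in Metric.closedBall (0 : E) 1, normWeight r x ∂μ < ∞ := by
  have hd : 0 < finrank ℝ E := Module.finrank_pos
  have h : IntegrableOn (fun x : E => ‖x‖ ^ r) (Metric.ball 0 2) μ := by
    rw [integrableOn_fun_norm_addHaar μ (f := fun t => t ^ r)]
    have h' : IntegrableOn (fun y : ℝ => y ^ ((finrank ℝ E - 1 : ℕ) + r)) (Set.Ioo 0 2) := by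
      rw [intervalIntegral.integrableOn_Ioo_rpow_iff two_pos, Nat.cast_sub hd]
      push_cast
      linarith
    refine h'.congr_fun (fun y hy => ?_) measurableSet_Ioo
    simp only [smul_eq_mul]
    rw [Real.rpow_add hy.1, Real.rpow_natCast]
  exact (lintegral_mono_set (Metric.closedBall_subset_ball one_lt_two)).trans_lt
    (Integrable.lintegral_lt_top h)

theorem lintegral_closedBall_normWeight (r : ℝ) {R : ℝ} (hR : 0 < R) :
    ∫⁻ x in Metric.closedBall (0 : E) R, normWeight r x ∂μ =
      ENNReal.ofReal (R ^ (r + finrank ℝ E)) *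
        ∫⁻ x in Metric.closedBall (0 : E) 1, normWeight r x ∂μ := by
  rw [← lintegral_indicator Metric.isClosed_closedBall.measurableSet,
    ← lintegral_indicator Metric.isClosed_closedBall.measurableSet,
    lintegral_comp_smul_addHaar μ ((measurable_normWeight r).indicator
      Metric.isClosed_closedBall.measurableSet) hR, add_comm r, Real.rpow_add hR,
    Real.rpow_natCast, ENNReal.ofReal_mul (by positivity), mul_assoc,
    ← lintegral_const_mul _ ((measurable_normWeight r).indicator
      Metric.isClosed_closedBall.measurableSet)]
  congr 2
  ext x
  have hiff : R • x ∈ Metric.closedBall (0 : E) R ↔ x ∈ Metric.closedBall (0 : E) 1 := by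
    simp only [mem_closedBall_zero_iff, norm_smul, Real.norm_of_nonneg hR.le]
    exact mul_le_iff_le_one_right hR
  by_cases hx : x ∈ Metric.closedBall (0 : E) 1
  · rw [Set.indicator_of_mem (hiff.2 hx), Set.indicator_of_mem hx, normWeight, normWeight,
      norm_smul, Real.norm_of_nonneg hR.le, Real.mul_rpow hR.le (norm_nonneg x),
      ENNReal.ofReal_mul (by positivity)]
  · rw [Set.indicator_of_notMem (fun h => hx (hiff.1 h)), Set.indicator_of_notMem hx, mul_zero]

theorem lintegral_lintegral_mul_sub {f g : E → ℝ≥0∞} (hf : Measurable f) (hg : Measurable g) :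
    ∫⁻ z, ∫⁻ x, f x * g (z - x) ∂μ ∂μ = (∫⁻ x, f x ∂μ) * ∫⁻ x, g x ∂μ := by
  rw [lintegral_lintegral_swap (by fun_prop), ← lintegral_mul_const _ hf]
  congr 1
  ext x
  rw [lintegral_const_mul _ (by fun_prop), lintegral_sub_right_eq_self g x]


/-- Weighted bound for the part of a convolution where the left argument is the smallest of the
three frequencies. -/
theorem lintegral_normWeight_mul_sq_conv_small_left_le [Nontrivial E] (a b : ℝ) {f g : E → ℝ≥0∞}
    (hf : Measurable f) (hg : Measurable g) :
    ∫⁻ z, normWeight (2 * (a + b) - finrank ℝ E) z *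
        (∫⁻ x in {x | ‖x‖ ≤ ‖z‖ ∧ ‖z‖ ≤ 2 * ‖z - x‖ ∧ ‖z - x‖ ≤ 2 * ‖z‖},
          f x * g (z - x) ∂μ) ^ 2 ∂μ ≤
      (∫⁻ x in Metric.closedBall (0 : E) 1, normWeight (-(2 * a)) x ∂μ) *
        ENNReal.ofReal (2 ^ |2 * b|) *
        ((∫⁻ x, normWeight (2 * a) x * f x ^ 2 ∂μ) * ∫⁻ x, normWeight (2 * b) x * g x ^ 2 ∂μ) := by
  rw [← lintegral_lintegral_mul_sub μ (by fun_prop) (by fun_prop),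
    ← lintegral_const_mul _ (by fun_prop)]
  apply lintegral_mono_ae
  filter_upwards [Measure.ae_ne μ (0 : E)] with z hz
  set S := {x : E | ‖x‖ ≤ ‖z‖ ∧ ‖z‖ ≤ 2 * ‖z - x‖ ∧ ‖z - x‖ ≤ 2 * ‖z‖} with hS
  have hSm : MeasurableSet S := by
    simp only [hS, Set.ofPred_and]
    refine .inter (measurableSet_le ?_ ?_)
      (.inter (measurableSet_le ?_ ?_) (measurableSet_le ?_ ?_)) <;> fun_prop
  set I := ∫⁻ x in Metric.closedBall (0 : E) 1, normWeight (-(2 * a)) x ∂μ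
  have hball : ∫⁻ x in S, normWeight (-a) x ^ 2 ∂μ ≤
      normWeight (-(2 * a) + finrank ℝ E) z * I := by
    rw [normWeight, ← lintegral_closedBall_normWeight μ _ (norm_pos_iff.2 hz)]
    simp only [normWeight_sq, mul_neg]
    exact lintegral_mono_set fun x hx => by simpa using hx.1
  have hCS : (∫⁻ x in S, f x * g (z - x) ∂μ) ^ 2 ≤
      normWeight (-(2 * a) + finrank ℝ E) z * I *
        ∫⁻ x in S, normWeight (2 * a) x * f x ^ 2 * g (z - x) ^ 2 ∂μ := by
    calc (∫⁻ x in S, f x * g (z - x) ∂μ) ^ 2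
        = (∫⁻ x in S, normWeight (-a) x * (normWeight a x * f x * g (z - x)) ∂μ) ^ 2 := by
          congr 1
          apply lintegral_congr_ae
          filter_upwards [ae_restrict_of_ae (Measure.ae_ne μ (0 : E))] with x hx
          rw [← mul_assoc, ← mul_assoc, mul_comm (normWeight (-a) x), normWeight_mul_neg hx,
            one_mul]
      _ ≤ _ := lintegral_mul_sq_le (by fun_prop) (by fun_prop)
      _ ≤ _ := by
          gcongr with x
          rw [mul_pow, mul_pow, normWeight_sq]
  calc normWeight (2 * (a + b) - finrank ℝ E) z * (∫⁻ x in S, f x * g (z - x) ∂μ) ^ 2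
      ≤ normWeight (2 * (a + b) - finrank ℝ E) z * (normWeight (-(2 * a) + finrank ℝ E) z * I *
        ∫⁻ x in S, normWeight (2 * a) x * f x ^ 2 * g (z - x) ^ 2 ∂μ) := by gcongr
    _ = I * ∫⁻ x in S, normWeight (2 * b) z *
          (normWeight (2 * a) x * f x ^ 2 * g (z - x) ^ 2) ∂μ := by
        rw [lintegral_const_mul _ (by fun_prop), ← mul_assoc, ← mul_assoc, normWeight_mul hz,
          show 2 * (a + b) - finrank ℝ E + (-(2 * a) + finrank ℝ E) = 2 * b by ring]
        ring
    _ ≤ I * ∫⁻ x in S, ENNReal.ofReal (2 ^ |2 * b|) * (normWeight (2 * a) x * f x ^ 2 *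
          (normWeight (2 * b) (z - x) * g (z - x) ^ 2)) ∂μ := by
        gcongr 1
        refine setLIntegral_mono (by fun_prop) fun x hx => ?_
        calc _ ≤ ENNReal.ofReal (2 ^ |2 * b|) * normWeight (2 * b) (z - x) *
              (normWeight (2 * a) x * f x ^ 2 * g (z - x) ^ 2) := by
              gcongr
              exact normWeight_le_of_comparable _ hz hx.2.1 hx.2.2
          _ = _ := by ring
    _ ≤ _ := by
        rw [lintegral_const_mul _ (by fun_prop), mul_assoc]
        gcongr
        exact Measure.restrict_le_self

/-- Weighted bound for the part of a convolution where the output frequency is the smallest of the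
three. -/
theorem lintegral_normWeight_mul_sq_conv_comparable_le [Nontrivial E] (a b : ℝ) {f g : E → ℝ≥0∞}
    (hf : Measurable f) (hg : Measurable g) :
    ∫⁻ z, normWeight (2 * (a + b) - finrank ℝ E) z *
        (∫⁻ x in {x | ‖z‖ ≤ ‖x‖ ∧ ‖x‖ ≤ 2 * ‖z - x‖ ∧ ‖z - x‖ ≤ 2 * ‖x‖},
          f x * g (z - x) ∂μ) ^ 2 ∂μ ≤
      (∫⁻ x in Metric.closedBall (0 : E) 1, normWeight (2 * (a + b) - finrank ℝ E) x ∂μ) *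
        ENNReal.ofReal (2 ^ |-(2 * b)|) *
        ((∫⁻ x, normWeight (2 * a) x * f x ^ 2 ∂μ) * ∫⁻ x, normWeight (2 * b) x * g x ^ 2 ∂μ) := by
  set e := 2 * (a + b) - finrank ℝ E with he
  set c := ENNReal.ofReal (2 ^ |-(2 * b)|)
  set I := ∫⁻ x in Metric.closedBall (0 : E) 1, normWeight e x ∂μ
  set B := ∫⁻ x, normWeight (2 * b) x * g x ^ 2 ∂μ
  have hCS (z : E) : (∫⁻ x in {x | ‖z‖ ≤ ‖x‖ ∧ ‖x‖ ≤ 2 * ‖z - x‖ ∧ ‖z - x‖ ≤ 2 * ‖x‖},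
      f x * g (z - x) ∂μ) ^ 2 ≤
      (∫⁻ x in {x | ‖z‖ ≤ ‖x‖}, c * (normWeight (-(2 * b)) x * f x ^ 2) ∂μ) * B := by
    set S := {x : E | ‖z‖ ≤ ‖x‖ ∧ ‖x‖ ≤ 2 * ‖z - x‖ ∧ ‖z - x‖ ≤ 2 * ‖x‖} with hS
    have hSm : MeasurableSet S := by
      simp only [hS, Set.ofPred_and]
      refine .inter (measurableSet_le ?_ ?_)
        (.inter (measurableSet_le ?_ ?_) (measurableSet_le ?_ ?_)) <;> fun_prop
    have hne : ∀ᵐ x ∂μ.restrict S, x ∈ S ∧ x ≠ 0 ∧ z - x ≠ 0 := by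
      filter_upwards [ae_restrict_of_ae (Measure.ae_ne μ (0 : E)), ae_restrict_mem hSm]
        with x hx hxS
      have := norm_pos_iff.2 hx
      exact ⟨hxS, hx, norm_pos_iff.1 (by linarith [hxS.2.1])⟩
    calc (∫⁻ x in S, f x * g (z - x) ∂μ) ^ 2
        = (∫⁻ x in S, (normWeight (-b) (z - x) * f x) *
            (normWeight b (z - x) * g (z - x)) ∂μ) ^ 2 := by
          congr 1
          apply lintegral_congr_ae
          filter_upwards [hne] with x hx
          rw [mul_mul_mul_comm, mul_comm (normWeight (-b) _), normWeight_mul_neg hx.2.2, one_mul]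
      _ ≤ _ := lintegral_mul_sq_le (by fun_prop) (by fun_prop)
      _ ≤ _ := by
          apply mul_le_mul'
          · calc _ ≤ ∫⁻ x in S, c * (normWeight (-(2 * b)) x * f x ^ 2) ∂μ := by
                  apply lintegral_mono_ae
                  filter_upwards [hne] with x hx
                  rw [mul_pow, normWeight_sq, ← mul_assoc, mul_neg]
                  gcongr
                  exact normWeight_le_of_comparable _ hx.2.2 hx.1.2.2 hx.1.2.1
              _ ≤ _ := lintegral_mono_set fun x hx => hx.1
          · calc _ ≤ ∫⁻ x, normWeight (2 * b) (z - x) * g (z - x) ^ 2 ∂μ := by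
                  simp only [mul_pow, normWeight_sq]
                  exact setLIntegral_le_lintegral _ _
              _ = B := lintegral_sub_left_eq_self (fun x => normWeight (2 * b) x * g x ^ 2) z
  have hm : MeasurableSet {p : E × E | ‖p.1‖ ≤ ‖p.2‖} :=
    measurableSet_le (by fun_prop) (by fun_prop)
  have hmeas : Measurable (Function.uncurry fun z x : E => {p : E × E | ‖p.1‖ ≤ ‖p.2‖}.indicator
      (fun p => normWeight e p.1 * (c * (normWeight (-(2 * b)) p.2 * f p.2 ^ 2))) (z, x)) :=
    Measurable.indicator (by fun_prop) hm
  calc _ ≤ ∫⁻ z, normWeight e z *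
        ((∫⁻ x in {x | ‖z‖ ≤ ‖x‖}, c * (normWeight (-(2 * b)) x * f x ^ 2) ∂μ) * B) ∂μ := by
        gcongr with z
        exact hCS z
    _ = ∫⁻ z, (∫⁻ x, {p : E × E | ‖p.1‖ ≤ ‖p.2‖}.indicator
          (fun p => normWeight e p.1 * (c * (normWeight (-(2 * b)) p.2 * f p.2 ^ 2))) (z, x) ∂μ) *
          B ∂μ := by
        congr 1
        ext z
        rw [← mul_assoc]
        congr 1
        rw [← lintegral_const_mul _ (by fun_prop), ← lintegral_indicator
          (measurableSet_le (by fun_prop) (by fun_prop))]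
        rfl
    _ = (∫⁻ x, ∫⁻ z, {p : E × E | ‖p.1‖ ≤ ‖p.2‖}.indicator
          (fun p => normWeight e p.1 * (c * (normWeight (-(2 * b)) p.2 * f p.2 ^ 2))) (z, x) ∂μ
          ∂μ) * B := by
        rw [lintegral_mul_const _ hmeas.lintegral_prod_right, lintegral_lintegral_swap
          hmeas.aemeasurable]
    _ = (∫⁻ x, I * c * (normWeight (2 * a) x * f x ^ 2) ∂μ) * B := by
        congr 1
        apply lintegral_congr_ae
        filter_upwards [Measure.ae_ne μ (0 : E)] with x hx
        calc _ = ∫⁻ z in Metric.closedBall (0 : E) ‖x‖,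
              normWeight e z * (c * (normWeight (-(2 * b)) x * f x ^ 2)) ∂μ := by
              rw [← lintegral_indicator Metric.isClosed_closedBall.measurableSet]
              congr 1
              ext z
              simp [Set.indicator]
          _ = normWeight (e + finrank ℝ E) x * I * (c * (normWeight (-(2 * b)) x * f x ^ 2)) := by
              rw [lintegral_mul_const _ (by fun_prop),
                lintegral_closedBall_normWeight μ _ (norm_pos_iff.2 hx)]
              rfl
          _ = I * c * (normWeight (e + finrank ℝ E) x * normWeight (-(2 * b)) x * f x ^ 2) := by
              ring
          _ = _ := by
              rw [normWeight_mul hx, he]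
              ring_nf
    _ = _ := by
        rw [lintegral_const_mul _ (by fun_prop), mul_assoc]

theorem lintegral_conv_le_add_add (f g : E → ℝ≥0∞) (z : E) :
    ∫⁻ x, f x * g (z - x) ∂μ ≤
      (∫⁻ x in {x | ‖x‖ ≤ ‖z‖ ∧ ‖z‖ ≤ 2 * ‖z - x‖ ∧ ‖z - x‖ ≤ 2 * ‖z‖}, f x * g (z - x) ∂μ) +
      (∫⁻ x in {x | ‖x‖ ≤ ‖z‖ ∧ ‖z‖ ≤ 2 * ‖z - x‖ ∧ ‖z - x‖ ≤ 2 * ‖z‖}, g x * f (z - x) ∂μ) +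
      ∫⁻ x in {x | ‖z‖ ≤ ‖x‖ ∧ ‖x‖ ≤ 2 * ‖z - x‖ ∧ ‖z - x‖ ≤ 2 * ‖x‖}, f x * g (z - x) ∂μ := by
  set S := {x : E | ‖x‖ ≤ ‖z‖ ∧ ‖z‖ ≤ 2 * ‖z - x‖ ∧ ‖z - x‖ ≤ 2 * ‖z‖} with hS
  set S' := {x : E | ‖z‖ ≤ ‖x‖ ∧ ‖x‖ ≤ 2 * ‖z - x‖ ∧ ‖z - x‖ ≤ 2 * ‖x‖} with hS'
  have hSm : MeasurableSet S := by
    simp only [hS, Set.ofPred_and]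
    refine .inter (measurableSet_le ?_ ?_)
      (.inter (measurableSet_le ?_ ?_) (measurableSet_le ?_ ?_)) <;> fun_prop
  have hswap : ∫⁻ x in S, g x * f (z - x) ∂μ =
      ∫⁻ x in {x | z - x ∈ S}, f x * g (z - x) ∂μ := by
    rw [← lintegral_indicator hSm, ← lintegral_sub_left_eq_self _ z,
      ← lintegral_indicator (show MeasurableSet {x | z - x ∈ S} from
        measurableSet_preimage (measurable_const_sub z) hSm)]
    congr 1
    ext x
    simp [Set.indicator, mul_comm]
  have hcover : Set.univ ⊆ S ∪ {x | z - x ∈ S} ∪ S' := by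
    intro x _
    have h1 : ‖z‖ ≤ ‖x‖ + ‖z - x‖ := by simpa using norm_add_le x (z - x)
    have h2 : ‖z - x‖ ≤ ‖z‖ + ‖x‖ := norm_sub_le z x
    have h3 : ‖x‖ ≤ ‖z‖ + ‖z - x‖ := by simpa using norm_sub_le z (z - x)
    simp only [Set.mem_union, hS, hS', Set.mem_ofPred_eq, sub_sub_cancel]
    grind
  calc ∫⁻ x, f x * g (z - x) ∂μ = ∫⁻ x in Set.univ, f x * g (z - x) ∂μ := by simp
    _ ≤ ∫⁻ x in S ∪ {x | z - x ∈ S} ∪ S', f x * g (z - x) ∂μ := lintegral_mono_set hcover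
    _ ≤ _ := lintegral_union_le _ _ _
    _ ≤ _ := by
        rw [hswap]
        gcongr
        exact lintegral_union_le _ _ _

/-- The homogeneous Sobolev product law on the Fourier side, for nonnegative functions on a
finite-dimensional space. -/
theorem exists_lintegral_normWeight_mul_sq_conv_le [Nontrivial E] {a b : ℝ} (hab : 0 < a + b)
    (ha : 2 * a < finrank ℝ E) (hb : 2 * b < finrank ℝ E) :
    ∃ K : ℝ≥0∞, K ≠ ∞ ∧ ∀ f g : E → ℝ≥0∞, Measurable f → Measurable g →
      ∫⁻ z, normWeight (2 * (a + b) - finrank ℝ E) z * (∫⁻ x, f x * g (z - x) ∂μ) ^ 2 ∂μ ≤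
        K * ((∫⁻ x, normWeight (2 * a) x * f x ^ 2 ∂μ) *
          ∫⁻ x, normWeight (2 * b) x * g x ^ 2 ∂μ) := by
  have hfin {r : ℝ} (hr : -(finrank ℝ E : ℝ) < r) (s : ℝ) :
      (∫⁻ x in Metric.closedBall (0 : E) 1, normWeight r x ∂μ) * ENNReal.ofReal (2 ^ |s|) ≠ ∞ :=
    ENNReal.mul_ne_top (lintegral_closedBall_one_normWeight_lt_top μ hr).ne ENNReal.ofReal_ne_top
  refine ⟨9 * (_ + _ + _), ENNReal.mul_ne_top (by simp) (ENNReal.add_ne_top.2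
    ⟨ENNReal.add_ne_top.2 ⟨hfin (r := -(2 * a)) (by linarith) (2 * b),
      hfin (r := -(2 * b)) (by linarith) (2 * a)⟩,
      hfin (r := 2 * (a + b) - finrank ℝ E) (by linarith) (-(2 * b))⟩), fun f g hf hg => ?_⟩
  have hA := lintegral_normWeight_mul_sq_conv_small_left_le μ a b hf hg
  have hB := lintegral_normWeight_mul_sq_conv_small_left_le μ b a hg hf
  have hC := lintegral_normWeight_mul_sq_conv_comparable_le μ a b hf hg
  rw [add_comm b a, mul_comm (∫⁻ x, normWeight (2 * b) x * g x ^ 2 ∂μ)] at hB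
  have hSm : MeasurableSet
      {p : E × E | ‖p.2‖ ≤ ‖p.1‖ ∧ ‖p.1‖ ≤ 2 * ‖p.1 - p.2‖ ∧ ‖p.1 - p.2‖ ≤ 2 * ‖p.1‖} := by
    simp only [Set.ofPred_and]
    refine .inter (measurableSet_le ?_ ?_)
      (.inter (measurableSet_le ?_ ?_) (measurableSet_le ?_ ?_)) <;> fun_prop
  have hmeas {u v : E → ℝ≥0∞} (hu : Measurable u) (hv : Measurable v) : Measurable fun z : E =>
      normWeight (2 * (a + b) - finrank ℝ E) z *
        (∫⁻ x in {x | ‖x‖ ≤ ‖z‖ ∧ ‖z‖ ≤ 2 * ‖z - x‖ ∧ ‖z - x‖ ≤ 2 * ‖z‖},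
          u x * v (z - x) ∂μ) ^ 2 :=
    (measurable_normWeight _).mul ((measurable_setLIntegral_slice μ hSm
      (h := fun z x => u x * v (z - x)) (by fun_prop)).pow_const 2)
  refine (lintegral_mono fun z => mul_le_mul_right ((pow_le_pow_left' (lintegral_conv_le_add_add μ
    f g z) 2).trans (ENNReal.add_add_sq_le _ _ _)) _).trans ?_
  simp only [mul_left_comm _ (9 : ℝ≥0∞), mul_add (normWeight _ _)]
  rw [lintegral_const_mul' _ _ (by simp), lintegral_add_left ((hmeas hf hg).fun_add (hmeas hg hf)),
    lintegral_add_left (hmeas hf hg), mul_assoc, add_mul, add_mul]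
  gcongr

end Haar

/-- Sobolev product law (Fourier-side form, second part): for `s₁ + s₂ > 0`, `s₁ < 3/2`,
`s₂ < 3/2`, there is `C > 0` so that for measurable `F, G : ℝ³ → ℂ` with
`‖F‖_{Ḣ^{s₁}} < ∞` and `‖G‖_{Ḣ^{s₂}} < ∞`, the convolution `F ∗ G` is a.e. well defined and
`‖F∗G‖_{Ḣ^{s₁+s₂−3/2}} ≤ C ‖F‖_{Ḣ^{s₁}} ‖G‖_{Ḣ^{s₂}}`
(all norms written as weighted integrals on the Fourier side). -/
theorem stmt_4 (s₁ s₂ : ℝ) (hs : 0 < s₁ + s₂) (hs₁ : s₁ < 3 / 2) (hs₂ : s₂ < 3 / 2) :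
    ∃ C > (0 : ℝ), ∀ F G : EuclideanSpace ℝ (Fin 3) → ℂ,
      Measurable F → Measurable G →
      Integrable (fun ξ => ‖ξ‖ ^ (2 * s₁) * ‖F ξ‖ ^ 2) →
      Integrable (fun ξ => ‖ξ‖ ^ (2 * s₂) * ‖G ξ‖ ^ 2) →
      (∀ᵐ ξ, Integrable (fun η => F η * G (ξ - η))) ∧
      (∫⁻ ξ, ENNReal.ofReal
            (‖ξ‖ ^ (2 * (s₁ + s₂ - 3 / 2)) * ‖∫ η, F η * G (ξ - η)‖ ^ 2)) ^ (1 / 2 : ℝ) ≤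
        ENNReal.ofReal (C *
          ((∫ ξ, ‖ξ‖ ^ (2 * s₁) * ‖F ξ‖ ^ 2) ^ (1 / 2 : ℝ) *
            (∫ ξ, ‖ξ‖ ^ (2 * s₂) * ‖G ξ‖ ^ 2) ^ (1 / 2 : ℝ))) := by
  obtain ⟨K, hK, hbound⟩ := exists_lintegral_normWeight_mul_sq_conv_le
    (volume : Measure (EuclideanSpace ℝ (Fin 3))) (a := s₁) (b := s₂) hs
    (by simp; linarith) (by simp; linarith)
  have hsum : 2 * (s₁ + s₂) - (finrank ℝ (EuclideanSpace ℝ (Fin 3)) : ℝ) =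
      2 * (s₁ + s₂ - 3 / 2) := by
    simp
    ring
  rw [hsum] at hbound
  have hofReal (s : ℝ) (H : ℂ) (x : EuclideanSpace ℝ (Fin 3)) :
      ENNReal.ofReal (‖x‖ ^ s * ‖H‖ ^ 2) = normWeight s x * ‖H‖ₑ ^ 2 := by
    rw [ENNReal.ofReal_mul (by positivity), ENNReal.ofReal_pow (norm_nonneg _), ofReal_norm,
      normWeight]
  have hnorm (s : ℝ) (H : EuclideanSpace ℝ (Fin 3) → ℂ)
      (hi : Integrable (fun ξ => ‖ξ‖ ^ (2 * s) * ‖H ξ‖ ^ 2)) :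
      ∫⁻ ξ, normWeight (2 * s) ξ * ‖H ξ‖ₑ ^ 2 =
        ENNReal.ofReal (∫ ξ, ‖ξ‖ ^ (2 * s) * ‖H ξ‖ ^ 2) := by
    rw [ofReal_integral_eq_lintegral_ofReal hi (ae_of_all _ fun ξ => by positivity)]
    simp only [hofReal]
  refine ⟨(K.toReal + 1) ^ (1 / 2 : ℝ), by positivity, fun F G hF hG hFi hGi => ?_⟩
  have h := hbound (fun x => ‖F x‖ₑ) (fun x => ‖G x‖ₑ) (by fun_prop) (by fun_prop)
  rw [hnorm s₁ F hFi, hnorm s₂ G hGi] at h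
  simp only [← enorm_mul] at h
  constructor
  · have hmeas : Measurable fun z : EuclideanSpace ℝ (Fin 3) =>
        ∫⁻ x, ‖F x * G (z - x)‖ₑ := by
      refine Measurable.lintegral_prod_right (f := fun z x => ‖F x * G (z - x)‖ₑ) ?_
      fun_prop
    have hfin := ae_lt_top ((measurable_normWeight _).mul (hmeas.pow_const 2))
      (h.trans_lt (ENNReal.mul_lt_top hK.lt_top (by finiteness))).ne
    filter_upwards [hfin, Measure.ae_ne volume (0 : EuclideanSpace ℝ (Fin 3))] with z hz hz0
    refine ⟨by fun_prop, ?_⟩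
    rw [hasFiniteIntegral_iff_enorm]
    by_contra htop
    rw [not_lt_top_iff] at htop
    simp only [Pi.mul_apply, htop] at hz
    simp [ENNReal.mul_top (normWeight_ne_zero hz0 _)] at hz
  · set A := ∫ ξ, ‖ξ‖ ^ (2 * s₁) * ‖F ξ‖ ^ 2
    set B := ∫ ξ, ‖ξ‖ ^ (2 * s₂) * ‖G ξ‖ ^ 2
    have hA : 0 ≤ A := integral_nonneg fun ξ => by positivity
    have hB : 0 ≤ B := integral_nonneg fun ξ => by positivity
    rw [← Real.mul_rpow hA hB, ← Real.mul_rpow (by positivity) (by positivity),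
      ← ENNReal.ofReal_rpow_of_nonneg (by positivity) (by norm_num)]
    gcongr
    calc ∫⁻ ξ, ENNReal.ofReal
            (‖ξ‖ ^ (2 * (s₁ + s₂ - 3 / 2)) * ‖∫ η, F η * G (ξ - η)‖ ^ 2)
        ≤ ∫⁻ ξ, normWeight (2 * (s₁ + s₂ - 3 / 2)) ξ * (∫⁻ η, ‖F η * G (ξ - η)‖ₑ) ^ 2 := by
          simp only [hofReal]
          gcongr with ξ
          exact enorm_integral_le_lintegral_enorm _
      _ ≤ K * (ENNReal.ofReal A * ENNReal.ofReal B) := h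
      _ ≤ ENNReal.ofReal ((K.toReal + 1) * (A * B)) := by
          rw [ENNReal.ofReal_mul (by positivity), ENNReal.ofReal_mul hA]
          gcongr
          rw [← ENNReal.ofReal_toReal hK]
          apply ENNReal.ofReal_le_ofReal
          simp
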